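/- Let d, M ≥ 1, σ_1,…,σ_M > 0, and let μ be a probability measure on ℝ^d with ∫ ‖x‖ dμ(x) < ∞. Let p(y|x) = ∏_{m=1}^M N(y_m; x, σ_m² I_d) be the Gaussian MNM kernel and p_Y(y) = ∫ p(y|x) dμ(x) the M-density. Let g : (ℝ^d)^M → (ℝ^d)^M be measurable with ∫ ‖g(y)‖ p_Y(y) dy < ∞ and ∫∫ ‖g(y)‖ ‖∇_y log p(y|x)‖ p(y|x) dμ(x) dy < ∞, where the m-th block of ∇_y log p(y|x) is (x − y_m)/σ_m². Then ∫ ⟨g(y), ∇_y log p_Y(y)⟩ p_Y(y) dy = ∫∫ ⟨g(y), ∇_y log p(y|x)⟩ p(y|x) dμ(x) dy. -/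

import Mathlib

open MeasureTheory Finset
open scoped RealInnerProductSpace

/-- The Gaussian multimeasurement noise-model kernel
`p(y|x) = ∏_{m=1}^M (2πσ_m²)^{-d/2} exp(−‖y_m − x‖²/(2σ_m²))`. -/
noncomputable def mnmKernel (d M : ℕ) (σ : Fin M → ℝ)
    (y : Fin M → EuclideanSpace ℝ (Fin d)) (x : EuclideanSpace ℝ (Fin d)) : ℝ :=
  ∏ m, (2 * Real.pi * σ m ^ 2) ^ (-(d : ℝ) / 2) *
    Real.exp (-‖y m - x‖ ^ 2 / (2 * σ m ^ 2))

/-- The Gaussian M-density `p_Y(y) = ∫ p(y|x) dμ(x)`. -/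
noncomputable def mDensity (d M : ℕ) (σ : Fin M → ℝ)
    (μ : Measure (EuclideanSpace ℝ (Fin d))) (y : Fin M → EuclideanSpace ℝ (Fin d)) : ℝ :=
  ∫ x, mnmKernel d M σ y x ∂μ

/-- The kernel is bounded by the product of its normalising constants. -/
theorem mnmKernel_le (d M : ℕ) (σ : Fin M → ℝ)
    (y : Fin M → EuclideanSpace ℝ (Fin d)) (x : EuclideanSpace ℝ (Fin d)) :
    mnmKernel d M σ y x ≤ ∏ m, (2 * Real.pi * σ m ^ 2) ^ (-(d : ℝ) / 2) := by
  refine Finset.prod_le_prod (fun m _ => by positivity) fun m _ => ?_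
  refine mul_le_of_le_one_right (by positivity) (Real.exp_le_one_iff.2 ?_)
  exact div_nonpos_of_nonpos_of_nonneg (neg_nonpos.2 (by positivity)) (by positivity)

theorem mnmKernel_pos {d M : ℕ} {σ : Fin M → ℝ} (hσ : ∀ m, 0 < σ m)
    (y : Fin M → EuclideanSpace ℝ (Fin d)) (x : EuclideanSpace ℝ (Fin d)) :
    0 < mnmKernel d M σ y x :=
  Finset.prod_pos fun m _ => by have := hσ m; positivity

theorem continuous_mnmKernel (d M : ℕ) (σ : Fin M → ℝ)
    (y : Fin M → EuclideanSpace ℝ (Fin d)) : Continuous (mnmKernel d M σ y) := by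
  unfold mnmKernel
  fun_prop

theorem integrable_mnmKernel {d M : ℕ} {σ : Fin M → ℝ} (hσ : ∀ m, 0 < σ m)
    (μ : Measure (EuclideanSpace ℝ (Fin d))) [IsFiniteMeasure μ]
    (y : Fin M → EuclideanSpace ℝ (Fin d)) : Integrable (mnmKernel d M σ y) μ :=
  .of_bound (continuous_mnmKernel d M σ y).aestronglyMeasurable _ <| ae_of_all _ fun x => by
    rw [Real.norm_of_nonneg (mnmKernel_pos hσ y x).le]
    exact mnmKernel_le d M σ y x

theorem mDensity_pos {d M : ℕ} {σ : Fin M → ℝ} (hσ : ∀ m, 0 < σ m)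
    (μ : Measure (EuclideanSpace ℝ (Fin d))) [IsProbabilityMeasure μ]
    (y : Fin M → EuclideanSpace ℝ (Fin d)) : 0 < mDensity d M σ μ y := by
  refine (integral_pos_iff_support_of_nonneg (fun x => (mnmKernel_pos hσ y x).le)
    (integrable_mnmKernel hσ μ y)).2 ?_
  have : Function.support (mnmKernel d M σ y) = Set.univ :=
    Set.eq_univ_of_forall fun x => (mnmKernel_pos hσ y x).ne'
  simp [this]

/-- The gradient of the kernel in its `m`-th block. -/
theorem hasGradientAt_mnmKernel_update {d M : ℕ} {σ : Fin M → ℝ} (hσ : ∀ m, 0 < σ m)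
    (y : Fin M → EuclideanSpace ℝ (Fin d)) (m : Fin M) (z x : EuclideanSpace ℝ (Fin d)) :
    HasGradientAt (fun z => mnmKernel d M σ (Function.update y m z) x)
      (mnmKernel d M σ (Function.update y m z) x • (σ m ^ 2)⁻¹ • (x - z)) z := by
  have hσm := (hσ m).ne'
  have hfactor : ∀ w, mnmKernel d M σ (Function.update y m w) x =
      ((2 * Real.pi * σ m ^ 2) ^ (-(d : ℝ) / 2) *
        ∏ j ∈ univ.erase m, (2 * Real.pi * σ j ^ 2) ^ (-(d : ℝ) / 2) *
          Real.exp (-‖y j - x‖ ^ 2 / (2 * σ j ^ 2))) *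
        Real.exp (-‖w - x‖ ^ 2 * (2 * σ m ^ 2)⁻¹) := by
    intro w
    rw [mnmKernel, ← mul_prod_erase _ _ (mem_univ m), Function.update_self, div_eq_mul_inv,
      mul_right_comm]
    congr 2
    refine prod_congr rfl fun j hj => ?_
    rw [Function.update_of_ne (ne_of_mem_erase hj)]
  simp only [hfactor]
  rw [hasGradientAt_iff_hasFDerivAt]
  have h := ((((hasFDerivAt_id z).sub_const x).norm_sq.neg.mul_const
    (2 * σ m ^ 2)⁻¹).exp).const_mul
      ((2 * Real.pi * σ m ^ 2) ^ (-(d : ℝ) / 2) *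
        ∏ j ∈ univ.erase m, (2 * Real.pi * σ j ^ 2) ^ (-(d : ℝ) / 2) *
          Real.exp (-‖y j - x‖ ^ 2 / (2 * σ j ^ 2)))
  refine h.congr_fderiv ?_
  ext v
  simp only [id, Pi.neg_apply, InnerProductSpace.toDual_apply_apply, real_inner_smul_left, inner_sub_left,
    smul_apply, neg_apply, ContinuousLinearMap.comp_apply,
    ContinuousLinearMap.id_apply, innerSL_apply_apply, smul_eq_mul]
  field_simp
  ring

theorem norm_mnmKernel_smul_le {d M : ℕ} {σ : Fin M → ℝ} (hσ : ∀ m, 0 < σ m)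
    (y : Fin M → EuclideanSpace ℝ (Fin d)) (m : Fin M) (z x : EuclideanSpace ℝ (Fin d)) :
    ‖mnmKernel d M σ y x • (σ m ^ 2)⁻¹ • (x - z)‖ ≤
      (∏ j, (2 * Real.pi * σ j ^ 2) ^ (-(d : ℝ) / 2)) * ((σ m ^ 2)⁻¹ * (‖x‖ + ‖z‖)) := by
  rw [norm_smul, norm_smul, Real.norm_of_nonneg (mnmKernel_pos hσ y x).le,
    Real.norm_of_nonneg (by positivity : 0 ≤ (σ m ^ 2)⁻¹)]
  gcongr
  · exact mnmKernel_le d M σ y x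
  · exact norm_sub_le x z

theorem continuous_mnmKernel_smul (d M : ℕ) (σ : Fin M → ℝ)
    (y : Fin M → EuclideanSpace ℝ (Fin d)) (m : Fin M) (z : EuclideanSpace ℝ (Fin d)) :
    Continuous fun x => mnmKernel d M σ y x • (σ m ^ 2)⁻¹ • (x - z) := by
  have := continuous_mnmKernel d M σ y
  fun_prop

theorem integrable_mnmKernel_smul {d M : ℕ} {σ : Fin M → ℝ} (hσ : ∀ m, 0 < σ m)
    {μ : Measure (EuclideanSpace ℝ (Fin d))} [IsFiniteMeasure μ]
    (hmom : Integrable (fun x => ‖x‖) μ)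
    (y : Fin M → EuclideanSpace ℝ (Fin d)) (m : Fin M) (z : EuclideanSpace ℝ (Fin d)) :
    Integrable (fun x => mnmKernel d M σ y x • (σ m ^ 2)⁻¹ • (x - z)) μ :=
  (((hmom.add (integrable_const ‖z‖)).const_mul _).const_mul _).mono'
    (continuous_mnmKernel_smul d M σ y m z).aestronglyMeasurable
    (ae_of_all _ fun x => norm_mnmKernel_smul_le hσ y m z x)

/-- Differentiation under the integral sign: the block gradient of the M-density. -/
theorem hasGradientAt_mDensity_update {d M : ℕ} {σ : Fin M → ℝ} (hσ : ∀ m, 0 < σ m)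
    {μ : Measure (EuclideanSpace ℝ (Fin d))} [IsFiniteMeasure μ]
    (hmom : Integrable (fun x => ‖x‖) μ)
    (y : Fin M → EuclideanSpace ℝ (Fin d)) (m : Fin M) (z : EuclideanSpace ℝ (Fin d)) :
    HasGradientAt (fun z => mDensity d M σ μ (Function.update y m z))
      (∫ x, mnmKernel d M σ (Function.update y m z) x • (σ m ^ 2)⁻¹ • (x - z) ∂μ) z := by
  have hintegrable := integrable_mnmKernel_smul hσ hmom (Function.update y m z) m z
  have hdual : Integrable (fun x => InnerProductSpace.toDual ℝ (EuclideanSpace ℝ (Fin d))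
      (mnmKernel d M σ (Function.update y m z) x • (σ m ^ 2)⁻¹ • (x - z))) μ := by
    refine hintegrable.norm.mono' ?_ (ae_of_all _ fun x => (LinearIsometryEquiv.norm_map _ _).le)
    exact (LinearIsometryEquiv.continuous _).comp_aestronglyMeasurable
      hintegrable.aestronglyMeasurable
  rw [hasGradientAt_iff_hasFDerivAt]
  have h := hasFDerivAt_integral_of_dominated_of_fderiv_le (μ := μ) (𝕜 := ℝ)
    (F := fun z x => mnmKernel d M σ (Function.update y m z) x)
    (F' := fun z x => InnerProductSpace.toDual ℝ (EuclideanSpace ℝ (Fin d))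
      (mnmKernel d M σ (Function.update y m z) x • (σ m ^ 2)⁻¹ • (x - z)))
    (bound := fun x => (∏ j, (2 * Real.pi * σ j ^ 2) ^ (-(d : ℝ) / 2)) *
      ((σ m ^ 2)⁻¹ * (‖x‖ + (‖z‖ + 1))))
    (Metric.ball_mem_nhds z one_pos)
    (Filter.Eventually.of_forall fun w =>
      (continuous_mnmKernel d M σ (Function.update y m w)).aestronglyMeasurable)
    (integrable_mnmKernel hσ μ (Function.update y m z))
    hdual.aestronglyMeasurable
    (ae_of_all _ fun x w hw => by
      rw [LinearIsometryEquiv.norm_map]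
      refine (norm_mnmKernel_smul_le hσ _ m w x).trans ?_
      have hw' : ‖w‖ ≤ ‖z‖ + 1 := by
        have := norm_le_norm_add_norm_sub' w z
        rw [mem_ball_iff_norm] at hw
        linarith
      have : 0 ≤ ∏ j, (2 * Real.pi * σ j ^ 2) ^ (-(d : ℝ) / 2) :=
        Finset.prod_nonneg fun j _ => by positivity
      gcongr)
    (((hmom.add (integrable_const (‖z‖ + 1))).const_mul _).const_mul _)
    (ae_of_all _ fun x w _ => (hasGradientAt_mnmKernel_update hσ y m w x).hasFDerivAt)
  refine h.congr_fderiv ?_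
  ext v
  rw [ContinuousLinearMap.integral_apply hdual, InnerProductSpace.toDual_apply_apply,
    real_inner_comm, ← integral_inner hintegrable]
  simp only [InnerProductSpace.toDual_apply_apply, real_inner_comm v]

/-- The cross-term identity underlying the equivalence of score matching and
multimeasurement denoising score matching:
`∫ ⟨g(y), ∇ log p_Y(y)⟩ p_Y(y) dy = ∫∫ ⟨g(y), ∇ log p(y|x)⟩ p(y|x) dμ(x) dy`.
Inner products on `(ℝ^d)^M` are written blockwise, and the `m`-th block of
`∇ log p_Y(y)` is `(∇_{y_m} p_Y(y))/p_Y(y)`, that of `∇ log p(y|x)` is `(x − y_m)/σ_m²`. -/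
theorem score_matching_cross_term (d M : ℕ) (hd : 1 ≤ d) (hM : 1 ≤ M)
    (σ : Fin M → ℝ) (hσ : ∀ m, 0 < σ m)
    (μ : Measure (EuclideanSpace ℝ (Fin d))) [IsProbabilityMeasure μ]
    (hmom : Integrable (fun x => ‖x‖) μ)
    (g : (Fin M → EuclideanSpace ℝ (Fin d)) → (Fin M → EuclideanSpace ℝ (Fin d)))
    (hg : Measurable g)
    (hint1 : Integrable
      (fun y => Real.sqrt (∑ m, ‖g y m‖ ^ 2) * mDensity d M σ μ y) volume)
    (hint2 : Integrable
      (fun q : (Fin M → EuclideanSpace ℝ (Fin d)) × EuclideanSpace ℝ (Fin d) =>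
        Real.sqrt (∑ m, ‖g q.1 m‖ ^ 2) *
          Real.sqrt (∑ m, ‖(σ m ^ 2)⁻¹ • (q.2 - q.1 m)‖ ^ 2) * mnmKernel d M σ q.1 q.2)
      (volume.prod μ)) :
    ∫ y, (∑ m, ⟪g y m,
          (mDensity d M σ μ y)⁻¹ •
            gradient (fun z => mDensity d M σ μ (Function.update y m z)) (y m)⟫) *
        mDensity d M σ μ y
      = ∫ y, ∫ x, (∑ m, ⟪g y m, (σ m ^ 2)⁻¹ • (x - y m)⟫) * mnmKernel d M σ y x ∂μ := by
  refine integral_congr_ae (ae_of_all _ fun y => ?_)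
  have hgrad : ∀ m, gradient (fun z => mDensity d M σ μ (Function.update y m z)) (y m) =
      ∫ x, mnmKernel d M σ y x • (σ m ^ 2)⁻¹ • (x - y m) ∂μ := fun m => by
    simpa using (hasGradientAt_mDensity_update hσ hmom y m (y m)).gradient
  have hi := fun m => integrable_mnmKernel_smul hσ hmom y m (y m)
  have hp := (mDensity_pos hσ μ y).ne'
  simp only [hgrad, sum_mul]
  rw [integral_finsetSum]
  · refine sum_congr rfl fun m _ => ?_
    rw [real_inner_smul_right, mul_right_comm, inv_mul_cancel₀ hp, one_mul,
      ← integral_inner (hi m)]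
    simp only [real_inner_smul_right, mul_comm]
  · intro m _
    refine ((hi m).const_inner (g y m)).congr (ae_of_all _ fun x => ?_)
    simp only [real_inner_smul_right, mul_comm]
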